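/- Let z_i = (y_i′, x_i′), i = 1, …, n, with y_i ∈ ℝ^q and x_i ∈ ℝ^p, and let kₙ = max over (v,w) ∈ ℝ^p × ℝ^q with ‖v‖+‖w‖ > 0 of #{i : v′x_i + w′y_i = 0}. Let ρ₀, ρ₁ be ρ-functions with ρ₁ ≤ ρ₀ pointwise, let (B̃, Γ̃) ∈ ℝ^{p×q} × S_q with det Γ̃ = 1, and let σ̂ = s(d₁(B̃, Γ̃), …, dₙ(B̃, Γ̃)) be the M-estimate of scale with function ρ₀ and b = 0.5. If kₙ/n < 0.5, then the function S(B, Γ) = ∑_{i=1}^n ρ₁(d_i(B, Γ)/σ̂) attains its infimum over {(B, Γ) ∈ ℝ^{p×q} × S_q : det Γ = 1} at some pair (B̂, Γ̂) in this set. -/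

import Mathlib

open MeasureTheory Matrix Filter ProbabilityTheory

noncomputable section

/-- Euclidean norm of a vector in `Fin q → ℝ`. -/
def euclNorm {q : ℕ} (v : Fin q → ℝ) : ℝ := Real.sqrt (∑ i, v i ^ 2)

/-- Frobenius (2-)norm of a matrix. -/
def frobNorm {p q : ℕ} (A : Matrix (Fin p) (Fin q) ℝ) : ℝ :=
  Real.sqrt (∑ i, ∑ j, A i j ^ 2)

/-- Spectral (operator) norm of a matrix. -/
def specNorm {p q : ℕ} (A : Matrix (Fin p) (Fin q) ℝ) : ℝ :=
  sSup ((fun v => euclNorm (A *ᵥ v)) '' {v | euclNorm v = 1})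

/-- Squared Mahalanobis norm `u′ Σ⁻¹ u`. -/
def mahSq {q : ℕ} (Sig : Matrix (Fin q) (Fin q) ℝ) (u : Fin q → ℝ) : ℝ :=
  u ⬝ᵥ (Sig⁻¹ *ᵥ u)

/-- Mahalanobis norm `(u′ Σ⁻¹ u)^{1/2}`. -/
def mah {q : ℕ} (Sig : Matrix (Fin q) (Fin q) ℝ) (u : Fin q → ℝ) : ℝ :=
  Real.sqrt (mahSq Sig u)

/-- Residual `y − B′x` of the observation `z = (y, x)`. -/
def resid {p q : ℕ} (B : Matrix (Fin p) (Fin q) ℝ) (z : (Fin q → ℝ) × (Fin p → ℝ)) :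
    Fin q → ℝ :=
  z.1 - Bᵀ *ᵥ z.2

/-- Mahalanobis norm of the residual of the observation `z` w.r.t. `(B, Σ)`. -/
def dMah {p q : ℕ} (B : Matrix (Fin p) (Fin q) ℝ) (Sig : Matrix (Fin q) (Fin q) ℝ)
    (z : (Fin q → ℝ) × (Fin p → ℝ)) : ℝ :=
  mah Sig (resid B z)

/-- A ρ-function: continuous, with values in `[0,1]`, `ρ(0)=0`, nondecreasing in `|u|`,
`sup ρ = 1`, and strictly increasing on `{u ≥ 0 : ρ u < 1}`. -/
structure IsRhoFunction (ρ : ℝ → ℝ) : Prop where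
  continuous : Continuous ρ
  map_zero : ρ 0 = 0
  nonneg : ∀ u, 0 ≤ ρ u
  le_one : ∀ u, ρ u ≤ 1
  mono_abs : ∀ u v : ℝ, |u| ≤ |v| → ρ u ≤ ρ v
  sup_eq_one : (⨆ u : ℝ, ρ u) = 1
  strict : ∀ u v : ℝ, 0 ≤ u → u < v → ρ u < 1 → ρ u < ρ v

/-- `s` is an M-estimate of scale of `v₁, …, vₙ` with ρ-function `ρ₀` and constant `b`. -/
def IsMScale {n : ℕ} (ρ₀ : ℝ → ℝ) (b : ℝ) (v : Fin n → ℝ) (s : ℝ) : Prop :=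
  (0 < s ∧ ∑ i, ρ₀ (v i / s) = b * n) ∨
    (s = 0 ∧ (n : ℝ) * (1 - b) ≤ (Finset.univ.filter (fun i => v i = 0)).card)

/-- The bilinear pairing `c′y + d′x` of a row `r = (c, d)` with an observation `z = (y, x)`. -/
def rowDot {p q : ℕ} (r z : (Fin q → ℝ) × (Fin p → ℝ)) : ℝ :=
  r.1 ⬝ᵥ z.1 + r.2 ⬝ᵥ z.2

/-- The Euclidean norm of `(r₁ ⬝ z, …, r_q ⬝ z)`; with `r = (C, -C B′)` and `C′C = Σ⁻¹` it is the
Mahalanobis norm of the residual. -/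
def rowNorm {p q : ℕ} (r : Fin q → (Fin q → ℝ) × (Fin p → ℝ))
    (z : (Fin q → ℝ) × (Fin p → ℝ)) : ℝ :=
  Real.sqrt (∑ j, rowDot (r j) z ^ 2)

/-- The square matrix formed by the first components of the rows. -/
def rowMatrix {p q : ℕ} (r : Fin q → (Fin q → ℝ) × (Fin p → ℝ)) : Matrix (Fin q) (Fin q) ℝ :=
  Matrix.of fun j => (r j).1

lemma continuous_rowNorm {p q : ℕ} (z : (Fin q → ℝ) × (Fin p → ℝ)) :
    Continuous fun r : Fin q → (Fin q → ℝ) × (Fin p → ℝ) => rowNorm r z := by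
  unfold rowNorm rowDot dotProduct
  fun_prop

lemma continuous_rowMatrix {p q : ℕ} :
    Continuous (rowMatrix : (Fin q → (Fin q → ℝ) × (Fin p → ℝ)) → _) := by
  refine continuous_matrix fun i j => ?_
  simp only [rowMatrix, Matrix.of_apply]
  fun_prop

lemma abs_rowDot_le_rowNorm {p q : ℕ} (r : Fin q → (Fin q → ℝ) × (Fin p → ℝ))
    (z : (Fin q → ℝ) × (Fin p → ℝ)) (j : Fin q) : |rowDot (r j) z| ≤ rowNorm r z := by
  apply Real.abs_le_sqrt
  exact Finset.single_le_sum (f := fun j => rowDot (r j) z ^ 2)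
    (fun _ _ => sq_nonneg _) (Finset.mem_univ j)

lemma mahSq_eq_sum_sq {q : ℕ} {Sig C : Matrix (Fin q) (Fin q) ℝ} (h : Sig⁻¹ = Cᵀ * C)
    (u : Fin q → ℝ) : mahSq Sig u = ∑ j, (C *ᵥ u) j ^ 2 := by
  rw [mahSq, h, ← Matrix.mulVec_mulVec, Matrix.dotProduct_mulVec, Matrix.vecMul_transpose]
  simp [dotProduct, sq]

lemma dMah_eq_rowNorm {p q : ℕ} {B : Matrix (Fin p) (Fin q) ℝ} {Sig C : Matrix (Fin q) (Fin q) ℝ}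
    (h : Sig⁻¹ = Cᵀ * C) {r : Fin q → (Fin q → ℝ) × (Fin p → ℝ)}
    (hr₁ : ∀ j, (r j).1 = C j) (hr₂ : ∀ j, (r j).2 = (-(C * Bᵀ)) j)
    (z : (Fin q → ℝ) × (Fin p → ℝ)) : dMah B Sig z = rowNorm r z := by
  rw [dMah, mah, rowNorm, mahSq_eq_sum_sq h]
  congr 1
  refine Finset.sum_congr rfl fun j _ => ?_
  have hj : (C *ᵥ resid B z) j = C j ⬝ᵥ z.1 + (-(C * Bᵀ)) j ⬝ᵥ z.2 := by
    rw [resid, Matrix.mulVec_sub, Matrix.mulVec_mulVec, sub_eq_add_neg, ← Matrix.neg_mulVec]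
    rfl
  rw [hj, rowDot, hr₁, hr₂]

open scoped MatrixOrder Matrix.Norms.L2Operator in
lemma exists_rows_of_posDef {p q : ℕ} (B : Matrix (Fin p) (Fin q) ℝ)
    {Γ : Matrix (Fin q) (Fin q) ℝ} (hΓ : Γ.PosDef) (hdet : Γ.det = 1) :
    ∃ r : Fin q → (Fin q → ℝ) × (Fin p → ℝ), (rowMatrix r).det ^ 2 = 1 ∧
      ∀ z, dMah B Γ z = rowNorm r z := by
  obtain ⟨C, hC⟩ := CStarAlgebra.nonneg_iff_eq_star_mul_self.mp hΓ.inv.posSemidef.nonneg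
  rw [Matrix.star_eq_conjTranspose, Matrix.conjTranspose_eq_transpose_of_trivial] at hC
  refine ⟨fun j => (C j, (-(C * Bᵀ)) j), ?_,
    dMah_eq_rowNorm hC (fun _ => rfl) (fun _ => rfl)⟩
  have h : (Γ⁻¹).det = 1 := by rw [Matrix.det_nonsing_inv, hdet, Ring.inverse_one]
  rw [hC, Matrix.det_mul, Matrix.det_transpose, ← sq] at h
  exact h

lemma exists_posDef_of_rows {p q : ℕ} (r : Fin q → (Fin q → ℝ) × (Fin p → ℝ))
    (hr : (rowMatrix r).det ^ 2 = 1) :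
    ∃ (B : Matrix (Fin p) (Fin q) ℝ) (Γ : Matrix (Fin q) (Fin q) ℝ), Γ.PosDef ∧ Γ.det = 1 ∧
      ∀ z, dMah B Γ z = rowNorm r z := by
  set C := rowMatrix r
  have hunit : IsUnit C.det := IsUnit.of_mul_eq_one C.det (by rw [← sq, hr])
  have hdet : (Cᵀ * C).det = 1 := by rw [Matrix.det_mul, Matrix.det_transpose, ← sq, hr]
  have hpos : (Cᵀ * C).PosDef := by
    rw [← Matrix.conjTranspose_eq_transpose_of_trivial]
    exact Matrix.PosDef.conjTranspose_mul_self C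
      (Matrix.mulVec_injective_of_isUnit ((Matrix.isUnit_iff_isUnit_det C).mpr hunit))
  let D : Matrix (Fin q) (Fin p) ℝ := Matrix.of fun j => (r j).2
  refine ⟨-(C⁻¹ * D)ᵀ, (Cᵀ * C)⁻¹, hpos.inv, ?_, dMah_eq_rowNorm (C := C) ?_ (fun _ => rfl) ?_⟩
  · rw [Matrix.det_nonsing_inv, hdet, Ring.inverse_one]
  · exact Matrix.nonsing_inv_nonsing_inv _ (by simp [hdet])
  · intro j
    rw [Matrix.transpose_neg, Matrix.transpose_transpose, Matrix.mul_neg, neg_neg,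
      Matrix.mul_nonsing_inv_cancel_left _ _ hunit]
    rfl

/-- The linear map `r ↦ (r ⬝ z i)_{i ∈ J}`. -/
def rowDotMap {p q n : ℕ} (z : Fin n → (Fin q → ℝ) × (Fin p → ℝ)) (J : Finset (Fin n)) :
    (Fin q → ℝ) × (Fin p → ℝ) →ₗ[ℝ] (J → ℝ) where
  toFun r i := rowDot r (z i)
  map_add' r s := by
    ext i
    simp only [rowDot, Prod.fst_add, Prod.snd_add, add_dotProduct, Pi.add_apply]
    ring
  map_smul' c r := by
    ext i
    simp only [rowDot, Prod.smul_fst, Prod.smul_snd, smul_dotProduct, Pi.smul_apply,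
      smul_eq_mul, RingHom.id_apply]
    ring

lemma exists_norm_le_of_card_lt {p q n : ℕ} (z : Fin n → (Fin q → ℝ) × (Fin p → ℝ)) (k : ℕ)
    (hk : ∀ r : (Fin q → ℝ) × (Fin p → ℝ), r ≠ 0 →
      (Finset.univ.filter fun i => rowDot r (z i) = 0).card ≤ k) (M : ℝ) (hM : 0 ≤ M) :
    ∃ R : ℝ, ∀ J : Finset (Fin n), k < J.card → ∀ r : (Fin q → ℝ) × (Fin p → ℝ),
      (∀ i ∈ J, |rowDot r (z i)| ≤ M) → ‖r‖ ≤ R := by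
  have key : ∀ J : Finset (Fin n), ∃ R : ℝ, 0 ≤ R ∧ (k < J.card →
      ∀ r : (Fin q → ℝ) × (Fin p → ℝ), (∀ i ∈ J, |rowDot r (z i)| ≤ M) → ‖r‖ ≤ R) := by
    intro J
    by_cases hJ : k < J.card
    · have hker : LinearMap.ker (rowDotMap z J) = ⊥ := by
        rw [LinearMap.ker_eq_bot']
        intro r hr
        by_contra hne
        refine absurd (hk r hne) (not_le.mpr (hJ.trans_le (Finset.card_le_card fun i hi => ?_)))
        exact Finset.mem_filter.mpr ⟨Finset.mem_univ i, congrFun hr ⟨i, hi⟩⟩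
      obtain ⟨K, -, hK⟩ := (rowDotMap z J).exists_antilipschitzWith hker
      refine ⟨K * M, by positivity, fun _ r hr => ?_⟩
      have h := hK.le_mul_dist r 0
      rw [map_zero, dist_zero_right, dist_zero_right] at h
      refine h.trans (mul_le_mul_of_nonneg_left ?_ K.2)
      exact (pi_norm_le_iff_of_nonneg hM).mpr fun i => hr i i.2
    · exact ⟨0, le_rfl, fun h => absurd h hJ⟩
  choose R hR₀ hR using key
  refine ⟨∑ J, R J, fun J hJ r hr => (hR J hJ r hr).trans ?_⟩
  exact Finset.single_le_sum (fun J _ => hR₀ J) (Finset.mem_univ J)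

lemma IsRhoFunction.exists_lt {ρ : ℝ → ℝ} (hρ : IsRhoFunction ρ) {a : ℝ} (ha : a < 1) :
    ∃ u, 0 ≤ u ∧ a < ρ u := by
  obtain ⟨u, hu⟩ := exists_lt_of_lt_ciSup (hρ.sup_eq_one.symm ▸ ha)
  exact ⟨|u|, abs_nonneg u, hu.trans_le (hρ.mono_abs _ _ (by rw [abs_abs]))⟩

/-- If `∑ᵢ ρ(dᵢ / σ) ≤ c < (n - k) ρ(M / σ)`, then more than `k` of the `dᵢ` are at most `M`. -/
lemma IsRhoFunction.lt_card_of_sum_le {ρ : ℝ → ℝ} (hρ : IsRhoFunction ρ) {n k : ℕ} {σ M c : ℝ}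
    (hσ : 0 < σ) (hM : 0 ≤ M) (hc : c < (n - k) * ρ (M / σ)) (d : Fin n → ℝ)
    (hsum : ∑ i, ρ (d i / σ) ≤ c) : k < (Finset.univ.filter fun i => d i ≤ M).card := by
  by_contra! hcard
  have hsplit := Finset.card_filter_add_card_filter_not (s := Finset.univ) (fun i => d i ≤ M)
  rw [Finset.card_univ, Fintype.card_fin] at hsplit
  set T := Finset.univ.filter fun i => ¬ d i ≤ M
  have hT : (n : ℝ) - k ≤ T.card := by
    rw [sub_le_iff_le_add]
    exact_mod_cast (by omega : n ≤ T.card + k)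
  have h₁ : T.card * ρ (M / σ) ≤ ∑ i ∈ T, ρ (d i / σ) := by
    rw [← nsmul_eq_mul]
    refine Finset.card_nsmul_le_sum _ _ _ fun i hi => hρ.mono_abs _ _ ?_
    have hi' : M < d i := not_le.mp (Finset.mem_filter.mp hi).2
    rw [abs_of_nonneg (by positivity), abs_of_nonneg (div_nonneg (hM.trans hi'.le) hσ.le)]
    gcongr
  have h₂ : ∑ i ∈ T, ρ (d i / σ) ≤ ∑ i, ρ (d i / σ) :=
    Finset.sum_le_sum_of_subset_of_nonneg (Finset.subset_univ T) fun i _ _ => hρ.nonneg _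
  have h₃ := mul_le_mul_of_nonneg_right hT (hρ.nonneg (M / σ))
  linarith

/-- Theorem 1 of the paper: if `kₙ/n < 1/2` then the objective
`S(B,Γ) = ∑ᵢ ρ₁(dᵢ(B,Γ)/σ̂)` attains its infimum over
`{(B,Γ) : Γ symmetric positive definite, det Γ = 1}`. -/
theorem exists_minimizer_MM_objective {p q n : ℕ}
    (z : Fin n → (Fin q → ℝ) × (Fin p → ℝ)) (kn : ℕ)
    (hkn : IsGreatest
      {k : ℕ | ∃ v : Fin p → ℝ, ∃ w : Fin q → ℝ, ¬(v = 0 ∧ w = 0) ∧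
        k = (Finset.univ.filter (fun i => v ⬝ᵥ (z i).2 + w ⬝ᵥ (z i).1 = 0)).card} kn)
    (hhalf : (kn : ℝ) / n < 1 / 2)
    (ρ₀ ρ₁ : ℝ → ℝ) (hρ₀ : IsRhoFunction ρ₀) (hρ₁ : IsRhoFunction ρ₁)
    (hle : ∀ u, ρ₁ u ≤ ρ₀ u)
    (Btil : Matrix (Fin p) (Fin q) ℝ) (Gtil : Matrix (Fin q) (Fin q) ℝ)
    (hGtil : Gtil.PosDef) (hdetGtil : Gtil.det = 1)
    (σhat : ℝ)
    (hσ : IsMScale ρ₀ (1 / 2) (fun i => dMah Btil Gtil (z i)) σhat) :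
    ∃ (Bhat : Matrix (Fin p) (Fin q) ℝ) (Ghat : Matrix (Fin q) (Fin q) ℝ),
      Ghat.PosDef ∧ Ghat.det = 1 ∧
      ∀ (B : Matrix (Fin p) (Fin q) ℝ) (Γ : Matrix (Fin q) (Fin q) ℝ),
        Γ.PosDef → Γ.det = 1 →
        ∑ i, ρ₁ (dMah Bhat Ghat (z i) / σhat) ≤ ∑ i, ρ₁ (dMah B Γ (z i) / σhat) := by
  rcases hσ with ⟨hσ, hsum⟩ | ⟨rfl, -⟩
  swap
  · exact ⟨Btil, Gtil, hGtil, hdetGtil, fun B Γ _ _ => by simp⟩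
  rcases Nat.eq_zero_or_pos n with rfl | hn
  · exact ⟨Btil, Gtil, hGtil, hdetGtil, fun B Γ _ _ => by simp⟩
  have hn' : (0 : ℝ) < n := Nat.cast_pos.mpr hn
  have hk : (kn : ℝ) < 1 / 2 * n := (div_lt_iff₀ hn').mp hhalf
  have hnk : (0 : ℝ) < n - kn := by linarith
  obtain ⟨u, hu₀, hu⟩ := hρ₁.exists_lt (a := 1 / 2 * n / (n - kn))
    ((div_lt_one hnk).mpr (by linarith))
  have hM : 0 ≤ u * σhat := mul_nonneg hu₀ hσ.le
  have hc : 1 / 2 * (n : ℝ) < (n - kn) * ρ₁ (u * σhat / σhat) := by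
    rw [mul_div_cancel_right₀ u hσ.ne', mul_comm ((n : ℝ) - kn)]
    exact (div_lt_iff₀ hnk).mp hu
  obtain ⟨R, hR⟩ := exists_norm_le_of_card_lt z kn (fun r hr => hkn.2
    ⟨r.2, r.1, fun h => hr (Prod.ext h.2 h.1), by simp only [rowDot, add_comm]⟩) _ hM
  let F : (Fin q → (Fin q → ℝ) × (Fin p → ℝ)) → ℝ := fun r => ∑ i, ρ₁ (rowNorm r (z i) / σhat)
  have hF : Continuous F := continuous_finsetSum _ fun i _ =>
    hρ₁.continuous.comp ((continuous_rowNorm (z i)).div_const σhat)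
  let K : Set (Fin q → (Fin q → ℝ) × (Fin p → ℝ)) :=
    {r | (rowMatrix r).det ^ 2 = 1} ∩ {r | F r ≤ 1 / 2 * n}
  have hKclosed : IsClosed K :=
    (isClosed_eq (continuous_rowMatrix.matrix_det.pow 2) continuous_const).inter
      (isClosed_le hF continuous_const)
  have hKbdd : K ⊆ Metric.closedBall 0 (max R 0) := by
    intro r hr
    rw [mem_closedBall_zero_iff, pi_norm_le_iff_of_nonneg (le_max_right R 0)]
    intro j
    refine (hR _ (hρ₁.lt_card_of_sum_le hσ hM hc _ hr.2) (r j) fun i hi => ?_).trans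
      (le_max_left R 0)
    exact (abs_rowDot_le_rowNorm r (z i) j).trans (Finset.mem_filter.mp hi).2
  have hKcomp : IsCompact K := (isCompact_closedBall _ _).of_isClosed_subset hKclosed hKbdd
  obtain ⟨rtil, hrdet, hrtil⟩ := exists_rows_of_posDef Btil hGtil hdetGtil
  have hrK : rtil ∈ K := by
    refine ⟨hrdet, le_trans (Finset.sum_le_sum fun i _ => ?_) hsum.le⟩
    rw [← hrtil]
    exact hle _
  obtain ⟨rhat, hrhat, hmin⟩ := hKcomp.exists_isMinOn ⟨rtil, hrK⟩ hF.continuousOn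
  obtain ⟨Bhat, Ghat, hG, hGdet, hhat⟩ := exists_posDef_of_rows rhat hrhat.1
  refine ⟨Bhat, Ghat, hG, hGdet, fun B Γ hΓ hΓdet => ?_⟩
  obtain ⟨r, hr, hrd⟩ := exists_rows_of_posDef B hΓ hΓdet
  simp only [hhat, hrd]
  change F rhat ≤ F r
  by_cases hrF : F r ≤ 1 / 2 * n
  · exact hmin ⟨hr, hrF⟩
  · exact hrhat.2.trans (not_le.mp hrF).le
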